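/- The function β ↦ δ_β(X,W) is non-decreasing on [0,1]: for all 0 ≤ β ≤ β' ≤ 1, δ_β(X,W) ≤ δ_{β'}(X,W). -/

import Mathlib

open Filter Real

/-- Shannon entropy (base 2) of a finitely supported probability mass function. -/
noncomputable def ent {A : Type} [Fintype A] (q : A → ℝ) : ℝ :=
  - ∑ a, q a * Real.logb 2 (q a)

/-- Joint law of the first `n+1` samples of a Markov chain with initial distribution `μ`
and transition matrix `P`. -/
noncomputable def chainJoint {X : Type} (μ : X → ℝ) (P : X → X → ℝ) (n : ℕ)
    (x : Fin (n + 1) → X) : ℝ :=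
  μ (x 0) * ∏ i : Fin n, P (x i.castSucc) (x i.succ)

/-- Joint law of `(Y_1, …, Y_{n+1})`, where `Y` is the stationary process obtained by
observing the stationary Markov chain `X ~ (μ, P)` through the channel `W`. -/
noncomputable def obsJoint {X Y : Type} [Fintype X] (μ : X → ℝ) (P : X → X → ℝ)
    (W : X → Y → ℝ) (n : ℕ) (y : Fin (n + 1) → Y) : ℝ :=
  ∑ x : Fin (n + 1) → X, chainJoint μ P n x * ∏ i, W (x i) (y i)

/-- A finite stochastic matrix is irreducible and aperiodic iff it is primitive, i.e., some
power (and hence all larger powers) of it is entrywise positive. -/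
def IrreducibleAperiodic {X : Type} [Fintype X] [DecidableEq X] (P : Matrix X X ℝ) : Prop :=
  ∃ N : ℕ, ∀ n ≥ N, ∀ x x' : X, 0 < (P ^ n) x x'

section Defs

variable {X Y : Type} [Fintype X] [Fintype Y]

/-- Marginal distribution `ν` of each `Y_k`: `νᵀ = μᵀ W`. -/
noncomputable def nuDist (μ : X → ℝ) (W : X → Y → ℝ) : Y → ℝ := fun y => ∑ x, μ x * W x y

/-- Joint distribution of `(Y_1, Y_2)`. -/
noncomputable def jointYY (μ : X → ℝ) (P : X → X → ℝ) (W : X → Y → ℝ) : Y × Y → ℝ :=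
  fun p => ∑ x, ∑ x', μ x * W x p.1 * P x x' * W x' p.2

/-- Joint distribution of `(X_1, Y_2)`. -/
noncomputable def jointX1Y2 (μ : X → ℝ) (P : X → X → ℝ) (W : X → Y → ℝ) : X × Y → ℝ :=
  fun p => ∑ x', μ p.1 * P p.1 x' * W x' p.2

/-- Joint distribution of `(X_2, Y_1)`. -/
noncomputable def jointX2Y1 (μ : X → ℝ) (P : X → X → ℝ) (W : X → Y → ℝ) : X × Y → ℝ :=
  fun p => ∑ x, μ x * W x p.2 * P x p.1

/-- Joint distribution of `(X_1, X_2)`. -/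
noncomputable def jointXX (μ : X → ℝ) (P : X → X → ℝ) : X × X → ℝ :=
  fun p => μ p.1 * P p.1 p.2

/-- Joint distribution of `(X_1, Y_1)`. -/
noncomputable def jointX1Y1 (μ : X → ℝ) (W : X → Y → ℝ) : X × Y → ℝ :=
  fun p => μ p.1 * W p.1 p.2

/-- Joint distribution of `(X_2, Y_2)`. -/
noncomputable def jointX2Y2 (μ : X → ℝ) (P : X → X → ℝ) (W : X → Y → ℝ) : X × Y → ℝ :=
  fun p => ∑ x, μ x * P x p.1 * W p.1 p.2

/-- Joint distribution of `(X_1, X_2, Y_2)`. -/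
noncomputable def jointX1X2Y2 (μ : X → ℝ) (P : X → X → ℝ) (W : X → Y → ℝ) :
    X × X × Y → ℝ :=
  fun p => μ p.1 * P p.1 p.2.1 * W p.2.1 p.2.2

/-- Joint distribution of `(X_1, X_2, Y_1)`. -/
noncomputable def jointX1X2Y1 (μ : X → ℝ) (P : X → X → ℝ) (W : X → Y → ℝ) :
    X × X × Y → ℝ :=
  fun p => μ p.1 * W p.1 p.2.2 * P p.1 p.2.1

/-- Joint distribution of `(X_1, Y_1, Y_2)`. -/
noncomputable def jointX1Y1Y2 (μ : X → ℝ) (P : X → X → ℝ) (W : X → Y → ℝ) :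
    X × Y × Y → ℝ :=
  fun p => ∑ x', μ p.1 * W p.1 p.2.1 * P p.1 x' * W x' p.2.2

/-- Conditional entropy `H(Y_2 | Y_1) = H(Y_1, Y_2) − H(Y_1)`. -/
noncomputable def HY2gY1 (μ : X → ℝ) (P : X → X → ℝ) (W : X → Y → ℝ) : ℝ :=
  ent (jointYY μ P W) - ent (nuDist μ W)

/-- Conditional entropy `H(Y_2 | X_1) = H(X_1, Y_2) − H(X_1)`. -/
noncomputable def HY2gX1 (μ : X → ℝ) (P : X → X → ℝ) (W : X → Y → ℝ) : ℝ :=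
  ent (jointX1Y2 μ P W) - ent μ

/-- Conditional entropy `H(Y_1 | X_2) = H(X_2, Y_1) − H(X_2)`. -/
noncomputable def HY1gX2 (μ : X → ℝ) (P : X → X → ℝ) (W : X → Y → ℝ) : ℝ :=
  ent (jointX2Y1 μ P W) - ent μ

/-- Mutual information `I(X_1; X_2) = H(X_1) + H(X_2) − H(X_1, X_2)` (stationary case). -/
noncomputable def IX1X2 (μ : X → ℝ) (P : X → X → ℝ) : ℝ :=
  2 * ent μ - ent (jointXX μ P)

/-- Mutual information `I(Y_1; Y_2) = H(Y_1) + H(Y_2) − H(Y_1, Y_2)` (stationary case). -/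
noncomputable def IY1Y2 (μ : X → ℝ) (P : X → X → ℝ) (W : X → Y → ℝ) : ℝ :=
  2 * ent (nuDist μ W) - ent (jointYY μ P W)

/-- The lumpability cost `C_L(X, W) = H(Y_2|Y_1) − H(Y_2|X_1)`. -/
noncomputable def CL (μ : X → ℝ) (P : X → X → ℝ) (W : X → Y → ℝ) : ℝ :=
  HY2gY1 μ P W - HY2gX1 μ P W

/-- The predictability cost `C_P(X, W) = I(X_1;X_2) − I(Y_1;Y_2)`. -/
noncomputable def CP (μ : X → ℝ) (P : X → X → ℝ) (W : X → Y → ℝ) : ℝ :=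
  IX1X2 μ P - IY1Y2 μ P W

/-- The aggregation cost `C_β(X, W) = (1−2β)·C_L(X,W) + β·C_P(X,W)`. -/
noncomputable def Cbeta (μ : X → ℝ) (P : X → X → ℝ) (W : X → Y → ℝ) (β : ℝ) : ℝ :=
  (1 - 2 * β) * CL μ P W + β * CP μ P W

/-- `δ_β(X,W) = (1−β)·(H(Y_2|Y_1) − H̄(Y)) + β·(I(X_1;X_2) − H(Y_1) + H̄(Y))`, where `hbarY`
denotes the entropy rate `H̄(Y)`. -/
noncomputable def deltaBeta (μ : X → ℝ) (P : X → X → ℝ) (W : X → Y → ℝ)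
    (hbarY β : ℝ) : ℝ :=
  (1 - β) * (HY2gY1 μ P W - hbarY) + β * (IX1X2 μ P - ent (nuDist μ W) + hbarY)

/-- Conditional mutual information
`I(X_1; X_2 | Y_2) = H(X_1,Y_2) + H(X_2,Y_2) − H(X_1,X_2,Y_2) − H(Y_2)`. -/
noncomputable def IX1X2gY2 (μ : X → ℝ) (P : X → X → ℝ) (W : X → Y → ℝ) : ℝ :=
  ent (jointX1Y2 μ P W) + ent (jointX2Y2 μ P W) - ent (jointX1X2Y2 μ P W) -
    ent (nuDist μ W)

/-- Conditional mutual information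
`I(X_2; X_1 | Y_1) = H(X_1,Y_1) + H(X_2,Y_1) − H(X_1,X_2,Y_1) − H(Y_1)`. -/
noncomputable def IX2X1gY1 (μ : X → ℝ) (P : X → X → ℝ) (W : X → Y → ℝ) : ℝ :=
  ent (jointX1Y1 μ W) + ent (jointX2Y1 μ P W) - ent (jointX1X2Y1 μ P W) -
    ent (nuDist μ W)

/-- Conditional mutual information
`I(Y_2; X_1 | Y_1) = H(X_1,Y_1) + H(Y_1,Y_2) − H(X_1,Y_1,Y_2) − H(Y_1)`. -/
noncomputable def IY2X1gY1 (μ : X → ℝ) (P : X → X → ℝ) (W : X → Y → ℝ) : ℝ :=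
  ent (jointX1Y1 μ W) + ent (jointYY μ P W) - ent (jointX1Y1Y2 μ P W) -
    ent (nuDist μ W)

/-- Mutual information `I(X_2; Y_1) = H(X_2) + H(Y_1) − H(X_2, Y_1)`. -/
noncomputable def IX2Y1 (μ : X → ℝ) (P : X → X → ℝ) (W : X → Y → ℝ) : ℝ :=
  ent μ + ent (nuDist μ W) - ent (jointX2Y1 μ P W)

/-- The deterministic channel induced by an aggregation function `g : X → Y`:
`W_{x→y} = 1` iff `y = g x`. -/
noncomputable def detW [DecidableEq Y] (g : X → Y) : X → Y → ℝ :=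
  fun x y => if g x = y then 1 else 0

/-- The row-stochastic matrix `R = P·W` for a deterministic aggregation `g`:
`R_{x→y} = ∑_{x' : g x' = y} P_{x→x'}`. -/
noncomputable def Rmat [DecidableEq Y] (P : X → X → ℝ) (g : X → Y) : X → Y → ℝ :=
  fun x y => ∑ x', if g x' = y then P x x' else 0

/-- Kullback–Leibler divergence (base 2) between two probability mass functions on `Y`. -/
noncomputable def klDiv2 (p q : Y → ℝ) : ℝ :=
  ∑ y, p y * Real.logb 2 (p y / q y)

end Defs

namespace DBM

open Finset

lemma helper_log (x k : ℝ) : x * k * (Real.log (x * k) - Real.log x) = x * k * Real.log k := by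
  by_cases hx : x = 0
  · simp [hx]
  by_cases hk : k = 0
  · simp [hk]
  rw [Real.log_mul hx hk]; ring

/-- Log-sum inequality. -/
lemma log_sum {I : Type} [Fintype I] (a b : I → ℝ) (ha : ∀ i, 0 ≤ a i) (hb : ∀ i, 0 ≤ b i)
    (hab : ∀ i, b i = 0 → a i = 0) :
    (∑ i, a i) * (Real.log (∑ i, a i) - Real.log (∑ i, b i)) ≤
      ∑ i, a i * (Real.log (a i) - Real.log (b i)) := by
  rcases (sum_nonneg (fun i _ => ha i) : 0 ≤ ∑ i, a i).eq_or_lt with hA | hA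
  · have h0 : ∀ i, a i = 0 := fun i =>
      (sum_eq_zero_iff_of_nonneg (fun i _ => ha i)).1 hA.symm i (mem_univ i)
    simp [h0]
  rcases (sum_nonneg (fun i _ => hb i) : 0 ≤ ∑ i, b i).eq_or_lt with hB | hB
  · have h0 : ∀ i, a i = 0 := fun i =>
      hab i ((sum_eq_zero_iff_of_nonneg (fun i _ => hb i)).1 hB.symm i (mem_univ i))
    simp [h0]
  set A := ∑ i, a i with hAdef
  set B := ∑ i, b i with hBdef
  have key : ∀ i, a i * (Real.log A - Real.log B) + a i - b i * (A / B) ≤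
      a i * (Real.log (a i) - Real.log (b i)) := by
    intro i
    rcases (ha i).eq_or_lt with h | h
    · rw [← h]
      have : 0 ≤ b i * (A / B) := mul_nonneg (hb i) (by positivity)
      simp only [zero_mul]; linarith
    · have hbi : 0 < b i := lt_of_le_of_ne (hb i) (fun h' => h.ne' (hab i h'.symm))
      have h1 := Real.log_le_sub_one_of_pos (x := b i * A / (a i * B)) (by positivity)
      rw [Real.log_div (by positivity) (by positivity), Real.log_mul hbi.ne' hA.ne',
        Real.log_mul h.ne' hB.ne'] at h1
      have h2 := mul_le_mul_of_nonneg_left h1 h.le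
      have h3 : a i * (b i * A / (a i * B) - 1) = b i * (A / B) - a i := by
        field_simp
      rw [h3] at h2
      linarith
  have h := sum_le_sum (fun i (_ : i ∈ univ) => key i)
  rw [sum_sub_distrib, sum_add_distrib, ← sum_mul, ← sum_mul, ← hAdef, ← hBdef] at h
  have : B * (A / B) = A := by field_simp
  linarith

/-- Natural-log version of the negated entropy. -/
noncomputable def L {A : Type} [Fintype A] (q : A → ℝ) : ℝ := ∑ a, q a * Real.log (q a)

lemma ent_eq {A : Type} [Fintype A] (q : A → ℝ) : ent q = - (L q / Real.log 2) := by
  simp only [ent, L, Real.logb, sum_div, mul_div_assoc]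

lemma markov {A B C : Type} [Fintype A] [Fintype B] [Fintype C]
    (f : A → B → ℝ) (K : B → C → ℝ) (hf : ∀ a b, 0 ≤ f a b) (hK : ∀ b c, 0 ≤ K b c)
    (hK1 : ∀ b, ∑ c, K b c = 1) :
    L (fun p : A × C => ∑ b, f p.1 b * K b p.2) - L (fun a => ∑ b, f a b) ≤
      L (fun p : B × C => (∑ a, f a p.1) * K p.1 p.2) - L (fun b => ∑ a, f a b) := by
  have e1 : L (fun p : A × C => ∑ b, f p.1 b * K b p.2) - L (fun a => ∑ b, f a b) =
      ∑ a, ∑ c, (∑ b, f a b * K b c) *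
        (Real.log (∑ b, f a b * K b c) - Real.log (∑ b, f a b)) := by
    simp only [L, Fintype.sum_prod_type, mul_sub, sum_sub_distrib]
    congr 1
    refine sum_congr rfl fun a _ => ?_
    rw [← sum_mul, sum_comm]
    simp only [← mul_sum, hK1, mul_one]
  have e2 : L (fun p : B × C => (∑ a, f a p.1) * K p.1 p.2) - L (fun b => ∑ a, f a b) =
      ∑ b, ∑ c, (∑ a, f a b) * K b c * Real.log (K b c) := by
    simp only [← helper_log]
    simp only [L, Fintype.sum_prod_type, mul_sub, sum_sub_distrib]
    congr 1
    refine sum_congr rfl fun a _ => ?_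
    rw [← sum_mul, ← mul_sum, hK1, mul_one]
  rw [e1, e2]
  have e3 : ∑ b, ∑ c, (∑ a, f a b) * K b c * Real.log (K b c) =
      ∑ a, ∑ c, ∑ b, f a b * K b c * Real.log (K b c) := by
    simp only [sum_mul]
    rw [sum_comm]
    rw [sum_comm (s := (univ : Finset A))]
    refine sum_congr rfl fun c _ => ?_
    rw [sum_comm]
  rw [e3]
  refine sum_le_sum fun a _ => sum_le_sum fun c _ => ?_
  simp only [← helper_log]
  exact log_sum _ _ (fun b => mul_nonneg (hf a b) (hK b c)) (fun b => hf a b)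
    (fun b h => by simp [h])

lemma superm {X Y : Type} [Fintype X] [Fintype Y] (r : X → X → ℝ) (W : X → Y → ℝ)
    (hr : ∀ a b, 0 ≤ r a b) (hW0 : ∀ x y, 0 ≤ W x y) (hW1 : ∀ x, ∑ y, W x y = 1)
    (u : X → Y → ℝ) (hu : ∀ x y, u x y = ∑ x', r x x' * W x' y)
    (v : X → Y → ℝ) (hv : ∀ x' y, v x' y = ∑ x, W x y * r x x')
    (w : Y → Y → ℝ) (hw : ∀ y z, w y z = ∑ x, W x y * u x z) :
    L (fun p : X × Y => v p.1 p.2) - L (fun p : Y × Y => w p.1 p.2) ≤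
      L (fun p : X × X => r p.1 p.2) - L (fun p : X × Y => u p.1 p.2) := by
  have hw' : ∀ y z, w y z = ∑ x', v x' y * W x' z := by
    intro y z
    simp only [hw, hu, hv, mul_sum, sum_mul]
    rw [sum_comm]
    exact sum_congr rfl fun _ _ => sum_congr rfl fun _ _ => by ring
  have hu0 : ∀ x y, 0 ≤ u x y := fun x y => by
    rw [hu]; exact sum_nonneg fun x' _ => mul_nonneg (hr _ _) (hW0 _ _)
  have key : ∀ y z x', W x' z * (v x' y * (Real.log (v x' y) - Real.log (w y z))) ≤
      W x' z * ∑ x, W x y * (r x x' * (Real.log (r x x') - Real.log (u x z))) := by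
    intro y z x'
    rcases (hW0 x' z).eq_or_lt with h | h
    · simp [← h]
    refine mul_le_mul_of_nonneg_left ?_ h.le
    rw [hv, hw]
    refine (log_sum _ _ (fun x => mul_nonneg (hW0 x y) (hr x x'))
      (fun x => mul_nonneg (hW0 x y) (hu0 x z)) ?_).trans (le_of_eq ?_)
    · intro x hx
      rcases mul_eq_zero.1 hx with h1 | h1
      · simp [h1]
      · rw [hu, sum_eq_zero_iff_of_nonneg fun x' _ => mul_nonneg (hr _ _) (hW0 _ _)] at h1
        have := h1 x' (mem_univ _)
        rcases mul_eq_zero.1 this with h2 | h2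
        · simp [h2]
        · exact absurd h2 h.ne'
    · refine sum_congr rfl fun x _ => ?_
      by_cases hWx : W x y = 0
      · simp [hWx]
      by_cases hrx : r x x' = 0
      · simp [hrx]
      have hux : u x z ≠ 0 := by
        intro h1
        rw [hu, sum_eq_zero_iff_of_nonneg fun x' _ => mul_nonneg (hr _ _) (hW0 _ _)] at h1
        have := h1 x' (mem_univ _)
        exact (mul_ne_zero hrx h.ne') this
      rw [Real.log_mul hWx hrx, Real.log_mul hWx hux]; ring
  have h := sum_le_sum fun y (_ : y ∈ univ) => sum_le_sum fun z (_ : z ∈ univ) =>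
    sum_le_sum fun x' (_ : x' ∈ univ) => key y z x'
  have e1 : L (fun p : X × Y => v p.1 p.2) - L (fun p : Y × Y => w p.1 p.2) =
      ∑ y, ∑ z, ∑ x', W x' z * (v x' y * (Real.log (v x' y) - Real.log (w y z))) := by
    simp only [L, Fintype.sum_prod_type, mul_sub, sum_sub_distrib]
    congr 1
    · rw [sum_comm]
      refine sum_congr rfl fun y _ => ?_
      rw [sum_comm]
      simp only [← sum_mul, hW1, one_mul]
    · refine sum_congr rfl fun y _ => sum_congr rfl fun z _ => ?_
      conv_lhs => rw [hw' y z, sum_mul]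
      rw [← hw' y z]
      exact sum_congr rfl fun _ _ => by ring
  have e2 : L (fun p : X × X => r p.1 p.2) - L (fun p : X × Y => u p.1 p.2) =
      ∑ y, ∑ z, ∑ x', W x' z *
        ∑ x, W x y * (r x x' * (Real.log (r x x') - Real.log (u x z))) := by
    have e3 : ∑ y, ∑ z, ∑ x', W x' z *
        ∑ x, W x y * (r x x' * (Real.log (r x x') - Real.log (u x z))) =
        ∑ z, ∑ x', ∑ x, W x' z * (r x x' * (Real.log (r x x') - Real.log (u x z))) := by
      rw [sum_comm]
      refine sum_congr rfl fun z _ => ?_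
      rw [sum_comm]
      refine sum_congr rfl fun x' _ => ?_
      rw [← mul_sum, sum_comm, mul_sum]
      refine sum_congr rfl fun x _ => ?_
      rw [← sum_mul, hW1, one_mul]
    rw [e3]
    simp only [L, Fintype.sum_prod_type, mul_sub, sum_sub_distrib]
    congr 1
    · rw [sum_comm, sum_comm (s := (univ : Finset Y))]
      refine sum_congr rfl fun x' _ => ?_
      rw [sum_comm]
      refine sum_congr rfl fun x _ => ?_
      rw [← sum_mul, hW1, one_mul]
    · rw [sum_comm]
      refine sum_congr rfl fun z _ => ?_
      rw [sum_comm]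
      refine sum_congr rfl fun x _ => ?_
      conv_lhs => rw [hu x z, sum_mul]
      rw [← hu x z]
      exact sum_congr rfl fun _ _ => by ring
  rw [e1, e2]; exact h

section Rec
variable {X Y : Type} [Fintype X]

/-- One filtering step. -/
noncomputable def step (P : X → X → ℝ) (W : X → Y → ℝ) (μ : X → ℝ) (c : Y) : X → ℝ :=
  fun x' => ∑ x, μ x * W x c * P x x'

lemma obs_zero (μ : X → ℝ) (P : X → X → ℝ) (W : X → Y → ℝ) (y : Fin 1 → Y) :
    obsJoint μ P W 0 y = ∑ x, μ x * W x (y 0) := by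
  unfold obsJoint chainJoint
  rw [← (Equiv.funUnique (Fin 1) X).symm.sum_comp]
  simp

lemma obs_succ (μ : X → ℝ) (P : X → X → ℝ) (W : X → Y → ℝ) (n : ℕ) (y : Fin (n + 2) → Y) :
    obsJoint μ P W (n + 1) y = obsJoint (step P W μ (y 0)) P W n (Fin.tail y) := by
  unfold obsJoint chainJoint step
  rw [← (Fin.consEquiv (fun _ : Fin (n + 2) => X)).sum_comp, Fintype.sum_prod_type, sum_comm]
  refine sum_congr rfl fun xs _ => ?_
  simp only [Fin.consEquiv_apply, sum_mul]
  refine sum_congr rfl fun x _ => ?_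
  rw [Fin.prod_univ_succ (n := n), Fin.prod_univ_succ (n := n + 1)]
  simp only [Fin.cons_zero, Fin.cons_succ, Fin.castSucc_zero, ← Fin.succ_castSucc, Fin.tail]
  ring

/-- Joint law of `(Y_0..Y_n, X_n)`. -/
noncomputable def fw (P : X → X → ℝ) (W : X → Y → ℝ) :
    (n : ℕ) → (X → ℝ) → (Fin (n + 1) → Y) → X → ℝ
  | 0, μ, y, x => μ x * W x (y 0)
  | n + 1, μ, y, x => fw P W n (step P W μ (y 0)) (Fin.tail y) x

/-- Conditional law of `(Y_0..Y_n)` given `X_0`. -/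
noncomputable def bw (P : X → X → ℝ) (W : X → Y → ℝ) :
    (n : ℕ) → (Fin (n + 1) → Y) → X → ℝ
  | 0, y, x => W x (y 0)
  | n + 1, y, x => W x (y 0) * ∑ x', P x x' * bw P W n (Fin.tail y) x'

lemma obs_fw (P : X → X → ℝ) (W : X → Y → ℝ) (n : ℕ) : ∀ (μ : X → ℝ) (y : Fin (n + 1) → Y),
    obsJoint μ P W n y = ∑ x, fw P W n μ y x := by
  induction n with
  | zero => intro μ y; simp only [obs_zero, fw]
  | succ n ih => intro μ y; rw [obs_succ, ih]; rfl

lemma obs_bw (P : X → X → ℝ) (W : X → Y → ℝ) (n : ℕ) : ∀ (μ : X → ℝ) (y : Fin (n + 1) → Y),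
    obsJoint μ P W n y = ∑ x, μ x * bw P W n y x := by
  induction n with
  | zero => intro μ y; simp only [obs_zero, bw]
  | succ n ih =>
    intro μ y; rw [obs_succ, ih]
    simp only [bw, step, sum_mul, mul_sum]
    rw [sum_comm]
    exact sum_congr rfl fun _ _ => sum_congr rfl fun _ _ => by ring

lemma fw_snoc (P : X → X → ℝ) (W : X → Y → ℝ) (n : ℕ) :
    ∀ (μ : X → ℝ) (y : Fin (n + 1) → Y) (c : Y) (x' : X),
    fw P W (n + 1) μ (Fin.snoc (α := fun _ => Y) y c) x' =
      ∑ x, fw P W n μ y x * (P x x' * W x' c) := by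
  induction n with
  | zero =>
    intro μ y c x'
    have h0 : (Fin.snoc (α := fun _ => Y) y c) 0 = y 0 := by
      rw [← Fin.castSucc_zero, Fin.snoc_castSucc]
    have h1 : Fin.tail (Fin.snoc (α := fun _ => Y) y c) 0 = c := by
      show (Fin.snoc (α := fun _ => Y) y c) (Fin.last 1) = c
      rw [Fin.snoc_last]
    simp only [fw, h0, h1, step, sum_mul]
    exact sum_congr rfl fun _ _ => by ring
  | succ n ih =>
    intro μ y c x'
    have h0 : (Fin.snoc (α := fun _ => Y) y c) 0 = y 0 := by
      rw [← Fin.castSucc_zero, Fin.snoc_castSucc]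
    have h1 : Fin.tail (Fin.snoc (α := fun _ => Y) y c) =
        Fin.snoc (α := fun _ => Y) (Fin.tail y) c := by
      conv_lhs => rw [← Fin.cons_self_tail y]
      rw [← Fin.cons_snoc_eq_snoc_cons, Fin.tail_cons]
    rw [fw, h0, h1, ih]
    rfl

lemma fw_nonneg (P : X → X → ℝ) (W : X → Y → ℝ)
    (hP0 : ∀ x x', 0 ≤ P x x') (hW0 : ∀ x y, 0 ≤ W x y) (n : ℕ) : ∀ (μ : X → ℝ) (y : Fin (n + 1) → Y) (x : X), (∀ x, 0 ≤ μ x) →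
    0 ≤ fw P W n μ y x := by
  induction n with
  | zero => intro μ y x h; exact mul_nonneg (h x) (hW0 _ _)
  | succ n ih =>
    intro μ y x h
    exact ih _ _ _ fun x' => sum_nonneg fun x _ =>
      mul_nonneg (mul_nonneg (h x) (hW0 _ _)) (hP0 _ _)

lemma bw_nonneg (P : X → X → ℝ) (W : X → Y → ℝ)
    (hP0 : ∀ x x', 0 ≤ P x x') (hW0 : ∀ x y, 0 ≤ W x y) (n : ℕ) : ∀ (y : Fin (n + 1) → Y) (x : X), 0 ≤ bw P W n y x := by
  induction n with
  | zero => intro y x; exact hW0 _ _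
  | succ n ih =>
    intro y x
    exact mul_nonneg (hW0 _ _) (sum_nonneg fun x' _ => mul_nonneg (hP0 _ _) (ih _ _))

end Rec

section Marg
variable {X Y : Type} [Fintype X] [Fintype Y]

lemma sum_cons {Z : Type} [Fintype Z] (n : ℕ) (F : (Fin (n + 2) → Z) → ℝ) :
    ∑ y, F y = ∑ c : Z, ∑ y : Fin (n + 1) → Z, F (Fin.cons (α := fun _ => Z) c y) := by
  rw [← (Fin.consEquiv (fun _ : Fin (n + 2) => Z)).sum_comp, Fintype.sum_prod_type]
  rfl

lemma sum_snoc {Z : Type} [Fintype Z] (n : ℕ) (F : (Fin (n + 2) → Z) → ℝ) :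
    ∑ y, F y = ∑ c : Z, ∑ y : Fin (n + 1) → Z, F (Fin.snoc (α := fun _ => Z) y c) := by
  rw [← (Fin.snocEquiv (fun _ : Fin (n + 2) => Z)).sum_comp, Fintype.sum_prod_type]
  rfl

lemma sum_bw (P : X → X → ℝ) (W : X → Y → ℝ) (hP1 : ∀ x, ∑ x', P x x' = 1)
    (hW1 : ∀ x, ∑ y, W x y = 1) (n : ℕ) : ∀ x, ∑ y, bw P W n y x = 1 := by
  induction n with
  | zero =>
    intro x
    rw [← (Equiv.funUnique (Fin 1) Y).symm.sum_comp]
    simpa [bw] using hW1 x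
  | succ n ih =>
    intro x
    rw [sum_cons]
    simp only [bw, Fin.cons_zero, Fin.tail_cons, ← mul_sum]
    rw [← sum_mul, hW1, one_mul, sum_comm]
    simp only [← mul_sum, ih, mul_one, hP1]

lemma sum_fw (P : X → X → ℝ) (W : X → Y → ℝ) (μ : X → ℝ)
    (hinv : ∀ x', ∑ x, μ x * P x x' = μ x')
    (hW1 : ∀ x, ∑ y, W x y = 1) (n : ℕ) : ∀ x, ∑ y, fw P W n μ y x = μ x := by
  induction n with
  | zero =>
    intro x
    rw [← (Equiv.funUnique (Fin 1) Y).symm.sum_comp]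
    simp [fw, ← mul_sum, hW1]
  | succ n ih =>
    intro x
    rw [sum_snoc]
    simp only [fw_snoc]
    rw [sum_comm]
    simp only [← mul_assoc]
    have : ∀ y : Fin (n + 1) → Y, ∑ c, ∑ x_1, fw P W n μ y x_1 * P x_1 x * W x c =
        ∑ x_1, fw P W n μ y x_1 * P x_1 x := by
      intro y
      rw [sum_comm]
      simp only [← mul_sum, hW1, mul_one]
    simp only [this]
    rw [sum_comm]
    simp only [← sum_mul, ih, hinv]

lemma pos_mu [DecidableEq X] (μ : X → ℝ) (P : X → X → ℝ)
    (hμ0 : ∀ x, 0 ≤ μ x) (hμ1 : ∑ x, μ x = 1)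
    (hinv : ∀ x', ∑ x, μ x * P x x' = μ x')
    (hirr : IrreducibleAperiodic (Matrix.of fun a b => P a b)) (x : X) : 0 < μ x := by
  obtain ⟨N, hN⟩ := hirr
  have h1 : Matrix.vecMul μ (Matrix.of fun a b => P a b) = μ := by
    ext x'; simpa [Matrix.vecMul, dotProduct] using hinv x'
  have h2 : ∀ n, Matrix.vecMul μ ((Matrix.of fun a b => P a b) ^ n) = μ := by
    intro n
    induction n with
    | zero => simp
    | succ n ih => rw [pow_succ, ← Matrix.vecMul_vecMul, ih, h1]
  have h3 : ∑ z, μ z * ((Matrix.of fun a b => P a b) ^ N) z x = μ x := congrFun (h2 N) x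
  rw [← h3]
  obtain ⟨z, -, hz⟩ : ∃ z ∈ univ, 0 < μ z := by
    by_contra hcon
    push Not at hcon
    have := sum_nonpos hcon
    rw [hμ1] at this
    linarith
  exact sum_pos' (fun z _ => mul_nonneg (hμ0 z) (hN N le_rfl z x).le)
    ⟨z, mem_univ _, mul_pos hz (hN N le_rfl z x)⟩

lemma bound1 (μ : X → ℝ) (P : X → X → ℝ) (W : X → Y → ℝ)
    (hμ0 : ∀ x, 0 ≤ μ x)
    (hP0 : ∀ x x', 0 ≤ P x x') (hP1 : ∀ x, ∑ x', P x x' = 1)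
    (hinv : ∀ x', ∑ x, μ x * P x x' = μ x')
    (hW0 : ∀ x y, 0 ≤ W x y) (hW1 : ∀ x, ∑ y, W x y = 1) (n : ℕ) :
    L (obsJoint μ P W (n + 1)) - L (obsJoint μ P W n) ≤ L (jointX1Y2 μ P W) - L μ := by
  have h := markov (fw P W n μ) (fun x c => ∑ x', P x x' * W x' c)
    (fun y x => fw_nonneg P W hP0 hW0 n μ y x hμ0)
    (fun x c => sum_nonneg fun x' _ => mul_nonneg (hP0 _ _) (hW0 _ _))
    (fun x => by rw [sum_comm]; simp only [← mul_sum, hW1, mul_one, hP1])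
  simp only [sum_fw P W μ hinv hW1] at h
  have e1 : L (obsJoint μ P W (n + 1)) =
      L (fun p : (Fin (n + 1) → Y) × Y => ∑ x, fw P W n μ p.1 x * ∑ x', P x x' * W x' p.2) := by
    unfold L
    rw [sum_snoc, Fintype.sum_prod_type, sum_comm]
    have : ∀ (y : Fin (n + 1) → Y) (c : Y),
        obsJoint μ P W (n + 1) (Fin.snoc (α := fun _ => Y) y c) =
        ∑ x, fw P W n μ y x * ∑ x', P x x' * W x' c := by
      intro y c
      rw [obs_fw]
      simp only [fw_snoc, mul_sum]
      rw [sum_comm]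
    simp only [this]
  have e2 : obsJoint μ P W n = fun y => ∑ x, fw P W n μ y x := funext fun y => obs_fw P W n μ y
  have e3 : jointX1Y2 μ P W = fun p : X × Y => μ p.1 * ∑ x', P p.1 x' * W x' p.2 := by
    funext p; simp only [jointX1Y2, mul_sum, mul_assoc]
  rw [e1, e2, e3]; exact h

lemma bound2 (μ : X → ℝ) (P : X → X → ℝ) (W : X → Y → ℝ)
    (hμ : ∀ x, 0 < μ x)
    (hP0 : ∀ x x', 0 ≤ P x x') (hP1 : ∀ x, ∑ x', P x x' = 1)
    (hinv : ∀ x', ∑ x, μ x * P x x' = μ x')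
    (hW0 : ∀ x y, 0 ≤ W x y) (hW1 : ∀ x, ∑ y, W x y = 1) (n : ℕ) :
    L (obsJoint μ P W (n + 1)) - L (obsJoint μ P W n) ≤ L (jointX2Y1 μ P W) - L μ := by
  have h := markov (fun y x => μ x * bw P W n y x) (fun x c => step P W μ c x / μ x)
    (fun y x => mul_nonneg (hμ x).le (bw_nonneg P W hP0 hW0 n y x))
    (fun x c => div_nonneg (sum_nonneg fun x' _ =>
      mul_nonneg (mul_nonneg (hμ _).le (hW0 _ _)) (hP0 _ _)) (hμ x).le)
    (fun x => by
      rw [← sum_div, div_eq_one_iff_eq (hμ x).ne']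
      simp only [step]
      rw [sum_comm]
      simp only [← sum_mul, ← mul_sum, hW1, mul_one, hinv])
  simp only [← mul_sum, sum_bw P W hP1 hW1, mul_one] at h
  have e1 : L (obsJoint μ P W (n + 1)) =
      L (fun p : (Fin (n + 1) → Y) × Y =>
        ∑ x, μ x * bw P W n p.1 x * (step P W μ p.2 x / μ x)) := by
    unfold L
    rw [sum_cons, Fintype.sum_prod_type, sum_comm]
    have : ∀ (y : Fin (n + 1) → Y) (c : Y),
        obsJoint μ P W (n + 1) (Fin.cons (α := fun _ => Y) c y) =
        ∑ x, μ x * bw P W n y x * (step P W μ c x / μ x) := by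
      intro y c
      rw [obs_succ, obs_bw, Fin.cons_zero, Fin.tail_cons]
      refine sum_congr rfl fun x _ => ?_
      have := (hμ x).ne'
      field_simp
    simp only [this]
  have e2 : obsJoint μ P W n = fun y => ∑ x, μ x * bw P W n y x :=
    funext fun y => obs_bw P W n μ y
  have e3 : jointX2Y1 μ P W = fun p : X × Y => μ p.1 * (step P W μ p.2 p.1 / μ p.1) := by
    funext p
    rw [mul_div_cancel₀ _ (hμ p.1).ne']
    rfl
  rw [e1, e2, e3]; exact h

end Marg

end DBM

/-- The function `β ↦ δ_β(X,W)` is non-decreasing on `[0,1]`. -/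
theorem deltaBeta_monotone
    {X Y : Type} [Fintype X] [Fintype Y] [Nonempty X] [Nonempty Y] [DecidableEq X]
    (μ : X → ℝ) (P : X → X → ℝ) (W : X → Y → ℝ)
    (hμ0 : ∀ x, 0 ≤ μ x) (hμ1 : ∑ x, μ x = 1)
    (hP0 : ∀ x x', 0 ≤ P x x') (hP1 : ∀ x, ∑ x', P x x' = 1)
    (hinv : ∀ x', ∑ x, μ x * P x x' = μ x')
    (hirr : IrreducibleAperiodic (Matrix.of fun a b => P a b))
    (hW0 : ∀ x y, 0 ≤ W x y) (hW1 : ∀ x, ∑ y, W x y = 1)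
    (hbarY : ℝ)
    (hlim : Filter.Tendsto (fun n => ent (obsJoint μ P W (n + 1)) - ent (obsJoint μ P W n))
      Filter.atTop (nhds hbarY)) :
    ∀ β β' : ℝ, 0 ≤ β → β ≤ β' → β' ≤ 1 →
      deltaBeta μ P W hbarY β ≤ deltaBeta μ P W hbarY β' := by
  intro β β' _ hββ _
  have hμ := DBM.pos_mu μ P hμ0 hμ1 hinv hirr
  have hl2 : 0 < Real.log 2 := Real.log_pos (by norm_num)
  have b1 : HY2gX1 μ P W ≤ hbarY := by
    refine ge_of_tendsto' hlim fun n => ?_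
    have := div_le_div_of_nonneg_right
      (DBM.bound1 μ P W hμ0 hP0 hP1 hinv hW0 hW1 n) hl2.le
    simp only [sub_div] at this
    simp only [HY2gX1, DBM.ent_eq]
    linarith
  have b2 : HY1gX2 μ P W ≤ hbarY := by
    refine ge_of_tendsto' hlim fun n => ?_
    have := div_le_div_of_nonneg_right
      (DBM.bound2 μ P W hμ hP0 hP1 hinv hW0 hW1 n) hl2.le
    simp only [sub_div] at this
    simp only [HY1gX2, DBM.ent_eq]
    linarith
  have b3 : ent (jointXX μ P) + ent (jointYY μ P W) ≤
      ent (jointX1Y2 μ P W) + ent (jointX2Y1 μ P W) := by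
    have h := DBM.superm (fun a b => μ a * P a b) W
      (fun a b => mul_nonneg (hμ0 a) (hP0 a b)) hW0 hW1
      (fun x y => jointX1Y2 μ P W (x, y)) (fun x y => rfl)
      (fun x y => jointX2Y1 μ P W (x, y))
      (fun x' y => by
        simp only [jointX2Y1]
        exact Finset.sum_congr rfl fun _ _ => by ring)
      (fun y z => jointYY μ P W (y, z))
      (fun y z => by
        simp only [jointYY, jointX1Y2, Finset.mul_sum]
        exact Finset.sum_congr rfl fun _ _ => Finset.sum_congr rfl fun _ _ => by ring)
    have h' : DBM.L (jointX2Y1 μ P W) - DBM.L (jointYY μ P W) ≤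
        DBM.L (jointXX μ P) - DBM.L (jointX1Y2 μ P W) := h
    have := div_le_div_of_nonneg_right h' hl2.le
    simp only [sub_div] at this
    simp only [DBM.ent_eq]
    linarith
  have hs : 0 ≤ IX1X2 μ P - ent (jointYY μ P W) + 2 * hbarY := by
    simp only [IX1X2, HY2gX1, HY1gX2] at *
    linarith
  have hm := mul_nonneg (sub_nonneg.2 hββ) hs
  simp only [deltaBeta, HY2gY1]
  linarith
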